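/- arXiv:2207.09180 — 8 statements merged into one kernel-verified Lean document; each statement's English description precedes it below -/
import Mathlib

section
/- In a symmetric monoidal category C, every comb family is a locally-applicable transformation: for all objects A, A', B, B', M and morphisms u : B ⟶ A ⊗ M, d : A' ⊗ M ⟶ B', the family Comb(u,d) satisfies, for all morphisms a : Y ⟶ X, b : X' ⟶ Y' and φ : A ⊗ X ⟶ A' ⊗ X', the equation Comb(u,d)_{Y,Y'}((𝟙_{A'} ⊗ b) ∘ φ ∘ (𝟙_A ⊗ a)) = (𝟙_{B'} ⊗ b) ∘ Comb(u,d)_{X,X'}(φ) ∘ (𝟙_B ⊗ a). -/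
open CategoryTheory MonoidalCategory

universe v u

variable {C : Type u} [Category.{v} C] [MonoidalCategory C] [SymmetricCategory C]

/-- A family of functions of type `[A,A'] → [B,B']`: for each pair of objects `X X'`,
a function from morphisms `A ⊗ X ⟶ A' ⊗ X'` to morphisms `B ⊗ X ⟶ B' ⊗ X'`. -/
def Fam (A A' B B' : C) : Type _ :=
  ∀ X X' : C, (A ⊗ X ⟶ A' ⊗ X') → (B ⊗ X ⟶ B' ⊗ X')

/-- A family is a locally-applicable transformation if it is natural in the extensions:
`S_{Y,Y'}((𝟙_{A'} ⊗ b) ∘ φ ∘ (𝟙_A ⊗ a)) = (𝟙_{B'} ⊗ b) ∘ S_{X,X'}(φ) ∘ (𝟙_B ⊗ a)`. -/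
def IsLAT {A A' B B' : C} (S : Fam A A' B B') : Prop :=
  ∀ {X X' Y Y' : C} (a : Y ⟶ X) (b : X' ⟶ Y') (φ : A ⊗ X ⟶ A' ⊗ X'),
    S Y Y' ((A ◁ a) ≫ φ ≫ (A' ◁ b)) = (B ◁ a) ≫ S X X' φ ≫ (B' ◁ b)

/-- The comb family `Comb(u,d)` of type `[A,A'] → [B,B']` determined by
`u : B ⟶ A ⊗ M` and `d : A' ⊗ M ⟶ B'`:
`Comb(u,d)_{X,X'}(φ) = (d ⊗ 𝟙_{X'}) ∘ (𝟙_{A'} ⊗ β_{X',M}) ∘ (φ ⊗ 𝟙_M) ∘ (𝟙_A ⊗ β_{M,X}) ∘ (u ⊗ 𝟙_X)`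
(associators inserted). -/
def comb {A A' B B' M : C} (u : B ⟶ A ⊗ M) (d : A' ⊗ M ⟶ B') : Fam A A' B B' :=
  fun X X' φ =>
    (u ▷ X) ≫ (α_ A M X).hom ≫ (A ◁ (β_ M X).hom) ≫ (α_ A X M).inv ≫
      (φ ▷ M) ≫ (α_ A' X' M).hom ≫ (A' ◁ (β_ X' M).hom) ≫ (α_ A' M X').inv ≫ (d ▷ X')

/-- Every comb family is a locally-applicable transformation. -/
theorem comb_isLAT {A A' B B' M : C} (u : B ⟶ A ⊗ M) (d : A' ⊗ M ⟶ B') :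
    IsLAT (comb u d) := by
  intro X X' Y Y' a b φ
  have hl : (u ▷ Y) ≫ (α_ A M Y).hom ≫ (A ◁ (β_ M Y).hom) ≫ (α_ A Y M).inv ≫ ((A ◁ a) ▷ M) =
      (B ◁ a) ≫ (u ▷ X) ≫ (α_ A M X).hom ≫ (A ◁ (β_ M X).hom) ≫ (α_ A X M).inv := by
    rw [whisker_exchange_assoc, ← associator_inv_naturality_middle, ← whiskerLeft_comp_assoc,
      ← BraidedCategory.braiding_naturality_right, whiskerLeft_comp_assoc,
      tensor_whiskerLeft]
    simp
  have hr : ((A' ◁ b) ▷ M) ≫ (α_ A' Y' M).hom ≫ (A' ◁ (β_ Y' M).hom) ≫ (α_ A' M Y').inv ≫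
        (d ▷ Y') =
      (α_ A' X' M).hom ≫ (A' ◁ (β_ X' M).hom) ≫ (α_ A' M X').inv ≫ (d ▷ X') ≫ (B' ◁ b) := by
    rw [← whisker_exchange, associator_naturality_middle_assoc, ← whiskerLeft_comp_assoc,
      BraidedCategory.braiding_naturality_left, whiskerLeft_comp_assoc,
      tensor_whiskerLeft]
    simp
  simp only [comb, comp_whiskerRight, Category.assoc]
  rw [hr]
  have := congrArg (fun f => f ≫ (φ ▷ M) ≫ (α_ A' X' M).hom ≫ (A' ◁ (β_ X' M).hom) ≫
    (α_ A' M X').inv ≫ (d ▷ X') ≫ (B' ◁ b)) hl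
  simpa only [Category.assoc] using this
end

section
/- Combs are closed under composition: in a symmetric monoidal category C, given u₁ : B ⟶ A ⊗ M₁, d₁ : A' ⊗ M₁ ⟶ B', u₂ : D ⟶ B ⊗ M₂ and d₂ : B' ⊗ M₂ ⟶ D', then for all objects X, X' and every φ : A ⊗ X ⟶ A' ⊗ X' one has Comb(u₂,d₂)_{X,X'}(Comb(u₁,d₁)_{X,X'}(φ)) = Comb(u,d)_{X,X'}(φ), where u := ((u₁ ⊗ 𝟙_{M₂}) ∘ u₂) : D ⟶ A ⊗ (M₁ ⊗ M₂) and d := (d₂ ∘ (d₁ ⊗ 𝟙_{M₂})) : A' ⊗ (M₁ ⊗ M₂) ⟶ D' (associators suppressed). -/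
open CategoryTheory MonoidalCategory

universe v u

variable {C : Type u} [Category.{v} C] [MonoidalCategory C] [SymmetricCategory C]

theorem comb_top {A B M₁ M₂ : C} (u₁ : B ⟶ A ⊗ M₁) (X : C) :
    (α_ B M₂ X).hom ≫ (B ◁ (β_ M₂ X).hom) ≫ (α_ B X M₂).inv ≫ (u₁ ▷ X) ▷ M₂ ≫
      (α_ A M₁ X).hom ▷ M₂ ≫ (A ◁ (β_ M₁ X).hom) ▷ M₂ ≫ (α_ A X M₁).inv ▷ M₂ =
    (u₁ ▷ M₂) ▷ X ≫ (α_ A M₁ M₂).hom ▷ X ≫ (α_ A (M₁ ⊗ M₂) X).hom ≫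
      (A ◁ (β_ (M₁ ⊗ M₂) X).hom) ≫ (α_ A X (M₁ ⊗ M₂)).inv ≫ (α_ (A ⊗ X) M₁ M₂).inv := by
  rw [← associator_inv_naturality_left_assoc, whisker_exchange_assoc,
    ← associator_naturality_left_assoc, BraidedCategory.braiding_tensor_left_hom]
  monoidal

theorem comb_bot {A' B' M₁ M₂ : C} (d₁ : A' ⊗ M₁ ⟶ B') (X' : C) :
    (α_ A' X' M₁).hom ▷ M₂ ≫ (A' ◁ (β_ X' M₁).hom) ▷ M₂ ≫ (α_ A' M₁ X').inv ▷ M₂ ≫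
      (d₁ ▷ X') ▷ M₂ ≫ (α_ B' X' M₂).hom ≫ (B' ◁ (β_ X' M₂).hom) ≫ (α_ B' M₂ X').inv =
    (α_ (A' ⊗ X') M₁ M₂).hom ≫ (α_ A' X' (M₁ ⊗ M₂)).hom ≫ (A' ◁ (β_ X' (M₁ ⊗ M₂)).hom) ≫
      (α_ A' (M₁ ⊗ M₂) X').inv ≫ (α_ A' M₁ M₂).inv ▷ X' ≫ (d₁ ▷ M₂) ▷ X' := by
  rw [associator_naturality_left_assoc, ← whisker_exchange_assoc,
    associator_inv_naturality_left, BraidedCategory.braiding_tensor_right_hom]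
  monoidal

/-- Combs are closed under composition: `Comb(u₂,d₂) ∘ Comb(u₁,d₁) = Comb(u,d)` where
`u = (u₁ ⊗ 𝟙_{M₂}) ∘ u₂` and `d = d₂ ∘ (d₁ ⊗ 𝟙_{M₂})` (associators inserted). -/
theorem comb_comp {A A' B B' D D' M₁ M₂ : C}
    (u₁ : B ⟶ A ⊗ M₁) (d₁ : A' ⊗ M₁ ⟶ B')
    (u₂ : D ⟶ B ⊗ M₂) (d₂ : B' ⊗ M₂ ⟶ D')
    (X X' : C) (φ : A ⊗ X ⟶ A' ⊗ X') :
    comb u₂ d₂ X X' (comb u₁ d₁ X X' φ) =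
      comb (u₂ ≫ (u₁ ▷ M₂) ≫ (α_ A M₁ M₂).hom)
        ((α_ A' M₁ M₂).inv ≫ (d₁ ▷ M₂) ≫ d₂) X X' φ := by
  simp only [comb, comp_whiskerRight, Category.assoc]
  have h1 := comb_top (M₂ := M₂) u₁ X
  have h2 := comb_bot (M₂ := M₂) d₁ X'
  have h3 : φ ▷ (M₁ ⊗ M₂) = (α_ _ M₁ M₂).inv ≫ (φ ▷ M₁) ▷ M₂ ≫ (α_ _ M₁ M₂).hom := by
    simp
  have h1' := fun {Z : C} (g : _ ⟶ Z) => congrArg (fun t => t ≫ g) h1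
  have h2' := fun {Z : C} (g : _ ⟶ Z) => congrArg (fun t => t ≫ g) h2
  simp only [Category.assoc] at h1' h2'
  rw [h1', h2', h3]
  simp only [Category.assoc]
end

section
/- The extension of a locally-applicable transformation is again a locally-applicable transformation: in a symmetric monoidal category C, if T is a locally-applicable transformation of type [B₁,B₁'] → [B₂,B₂'] and A, A' are objects, then the (A,A')-extension ext(T) is a locally-applicable transformation of type [A ⊗ B₁, A' ⊗ B₁'] → [A ⊗ B₂, A' ⊗ B₂']; explicitly, for all a : Y ⟶ X, b : X' ⟶ Y' and ψ : A ⊗ B₁ ⊗ X ⟶ A' ⊗ B₁' ⊗ X', ext(T)_{Y,Y'}((𝟙_{A'⊗B₁'} ⊗ b) ∘ ψ ∘ (𝟙_{A⊗B₁} ⊗ a)) = (𝟙_{A'⊗B₂'} ⊗ b) ∘ ext(T)_{X,X'}(ψ) ∘ (𝟙_{A⊗B₂} ⊗ a). -/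
open CategoryTheory MonoidalCategory

universe v u

variable {C : Type u} [Category.{v} C] [MonoidalCategory C] [SymmetricCategory C]

/-- The `(A,A')`-extension of a family `T` of type `[B₁,B₁'] → [B₂,B₂']`:
`ext(T)_{X,X'}(ψ) = (β_{B₂',A'} ⊗ 𝟙_{X'}) ∘ T_{A⊗X,A'⊗X'}((β_{A',B₁'} ⊗ 𝟙_{X'}) ∘ ψ ∘ (β_{B₁,A} ⊗ 𝟙_X)) ∘ (β_{A,B₂} ⊗ 𝟙_X)`
(associators inserted; `T` is applied with extension objects `A ⊗ X` and `A' ⊗ X'`). -/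
def ext {B₁ B₁' B₂ B₂' : C} (A A' : C) (T : Fam B₁ B₁' B₂ B₂') :
    ∀ X X' : C, ((A ⊗ B₁) ⊗ X ⟶ (A' ⊗ B₁') ⊗ X') → ((A ⊗ B₂) ⊗ X ⟶ (A' ⊗ B₂') ⊗ X') :=
  fun X X' ψ =>
    ((β_ A B₂).hom ▷ X) ≫ (α_ B₂ A X).hom ≫
      T (A ⊗ X) (A' ⊗ X')
        ((α_ B₁ A X).inv ≫ ((β_ B₁ A).hom ▷ X) ≫ ψ ≫ ((β_ A' B₁').hom ▷ X') ≫
          (α_ B₁' A' X').hom) ≫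
      (α_ B₂' A' X').inv ≫ ((β_ B₂' A').hom ▷ X')

/-- Application of a family `S` of type `[A₁,A₁'] → [A₂,A₂']` with extension objects
`B ⊗ X` and `B' ⊗ X'`, reassociated so that it acts on morphisms
`(A₁ ⊗ B) ⊗ X ⟶ (A₁' ⊗ B') ⊗ X'`. -/
def onPair {A₁ A₁' A₂ A₂' : C} (S : Fam A₁ A₁' A₂ A₂') (B B' X X' : C)
    (φ : (A₁ ⊗ B) ⊗ X ⟶ (A₁' ⊗ B') ⊗ X') : (A₂ ⊗ B) ⊗ X ⟶ (A₂' ⊗ B') ⊗ X' :=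
  (α_ A₂ B X).hom ≫
    S (B ⊗ X) (B' ⊗ X') ((α_ A₁ B X).inv ≫ φ ≫ (α_ A₁' B' X').hom) ≫
    (α_ A₂' B' X').inv

/-- A slot is a locally-applicable transformation which commutes with the extension of
every other locally-applicable transformation acting on a complementary tensor factor. -/
def IsSlot {A₁ A₁' A₂ A₂' : C} (S : Fam A₁ A₁' A₂ A₂') : Prop :=
  IsLAT S ∧
    ∀ {B₁ B₁' B₂ B₂' : C} (T : Fam B₁ B₁' B₂ B₂'), IsLAT T →
      ∀ (X X' : C) (φ : (A₁ ⊗ B₁) ⊗ X ⟶ (A₁' ⊗ B₁') ⊗ X'),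
        ext A₂ A₂' T X X' (onPair S B₁ B₁' X X' φ) =
          onPair S B₂ B₂' X X' (ext A₁ A₁' T X X' φ)

/-- The extension of a locally-applicable transformation of type `[B₁,B₁'] → [B₂,B₂']`
is a locally-applicable transformation of type `[A ⊗ B₁, A' ⊗ B₁'] → [A ⊗ B₂, A' ⊗ B₂']`. -/
theorem ext_isLAT {B₁ B₁' B₂ B₂' : C} (A A' : C) (T : Fam B₁ B₁' B₂ B₂') (hT : IsLAT T) :
    IsLAT (ext A A' T : Fam (A ⊗ B₁) (A' ⊗ B₁') (A ⊗ B₂) (A' ⊗ B₂')) := by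
  intro X X' Y Y' a b ψ
  have key : (α_ B₁ A Y).inv ≫ ((β_ B₁ A).hom ▷ Y) ≫
      (((A ⊗ B₁) ◁ a) ≫ ψ ≫ ((A' ⊗ B₁') ◁ b)) ≫ ((β_ A' B₁').hom ▷ Y') ≫ (α_ B₁' A' Y').hom =
      (B₁ ◁ (A ◁ a)) ≫ ((α_ B₁ A X).inv ≫ ((β_ B₁ A).hom ▷ X) ≫ ψ ≫
        ((β_ A' B₁').hom ▷ X') ≫ (α_ B₁' A' X').hom) ≫ (B₁' ◁ (A' ◁ b)) := by
    simp only [Category.assoc]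
    rw [← whisker_exchange_assoc, whisker_exchange_assoc (β_ A' B₁').hom b]
    simp
  have hl : ∀ {Z : C} (h : B₂ ⊗ A ⊗ X ⟶ Z),
      ((β_ A B₂).hom ▷ Y) ≫ (α_ B₂ A Y).hom ≫ (B₂ ◁ (A ◁ a)) ≫ h =
      ((A ⊗ B₂) ◁ a) ≫ ((β_ A B₂).hom ▷ X) ≫ (α_ B₂ A X).hom ≫ h := by
    intro Z h
    rw [whisker_exchange_assoc]; simp
  have hr : (B₂' ◁ (A' ◁ b)) ≫ (α_ B₂' A' Y').inv ≫ ((β_ B₂' A').hom ▷ Y') =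
      (α_ B₂' A' X').inv ≫ ((β_ B₂' A').hom ▷ X') ≫ ((A' ⊗ B₂') ◁ b) := by
    rw [← whisker_exchange]; simp
  unfold ext
  rw [key, hT]
  simp only [Category.assoc]
  rw [hr, hl]
end

section
/- Slots are closed under composition: in a symmetric monoidal category C, if S is a slot of type [A₁,A₁'] → [A₂,A₂'] and S' is a slot of type [A₂,A₂'] → [A₃,A₃'], then the componentwise composite family (S' ∘ S)_{X,X'} := S'_{X,X'} ∘ S_{X,X'} is a slot of type [A₁,A₁'] → [A₃,A₃']. -/
open CategoryTheory MonoidalCategory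

universe v u

variable {C : Type u} [Category.{v} C] [MonoidalCategory C] [SymmetricCategory C]

/-- Slots are closed under (componentwise sequential) composition. -/
theorem slot_comp {A₁ A₁' A₂ A₂' A₃ A₃' : C}
    (S : Fam A₁ A₁' A₂ A₂') (S' : Fam A₂ A₂' A₃ A₃')
    (hS : IsSlot S) (hS' : IsSlot S') :
    IsSlot (fun X X' φ => S' X X' (S X X' φ) : Fam A₁ A₁' A₃ A₃') := by
  have key : ∀ (B B' X X' : C) (φ : (A₁ ⊗ B) ⊗ X ⟶ (A₁' ⊗ B') ⊗ X'),
      onPair (fun X X' φ => S' X X' (S X X' φ) : Fam A₁ A₁' A₃ A₃') B B' X X' φ =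
        onPair S' B B' X X' (onPair S B B' X X' φ) := by
    intro B B' X X' φ
    simp [onPair]
  refine ⟨?_, ?_⟩
  · intro X X' Y Y' a b φ
    show S' Y Y' (S Y Y' _) = _
    rw [hS.1 a b φ, hS'.1 a b]
  · intro B₁ B₁' B₂ B₂' T hT X X' φ
    rw [key, key, hS'.2 T hT, hS.2 T hT]
end

section
/- Interchange law for the parallel composition of slots: in a symmetric monoidal category C, define for a locally-applicable transformation S of type [A₁,A₁'] → [A₂,A₂'] and a locally-applicable transformation T of type [B₁,B₁'] → [B₂,B₂'] the family (S ⊡ T)_{X,X'}(φ) := S_{B₂⊗X,B₂'⊗X'}(ext(T)_{X,X'}(φ)) for φ : A₁ ⊗ B₁ ⊗ X ⟶ A₁' ⊗ B₁' ⊗ X', where ext(T) is the (A₁,A₁')-extension of T. Then for slots S : [A₁,A₁'] → [A₂,A₂'] and S' : [A₂,A₂'] → [A₃,A₃'] and locally-applicable transformations T : [B₁,B₁'] → [B₂,B₂'] and T' : [B₂,B₂'] → [B₃,B₃'], for all X, X' and all φ : A₁ ⊗ B₁ ⊗ X ⟶ A₁' ⊗ B₁' ⊗ X' one has (S' ⊡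 T')_{X,X'}((S ⊡ T)_{X,X'}(φ)) = ((S' ∘ S) ⊡ (T' ∘ T))_{X,X'}(φ), where composites of locally-applicable transformations are taken componentwise. -/
open CategoryTheory MonoidalCategory

universe v u

variable {C : Type u} [Category.{v} C] [MonoidalCategory C] [SymmetricCategory C]

/-- The parallel composite `S ⊡ T` of a family `S` of type `[A₁,A₁'] → [A₂,A₂']` and a
family `T` of type `[B₁,B₁'] → [B₂,B₂']`:
`(S ⊡ T)_{X,X'}(φ) := S_{B₂⊗X,B₂'⊗X'}(ext(T)_{X,X'}(φ))` where `ext(T)` is the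
`(A₁,A₁')`-extension of `T`. -/
def boxTimes {A₁ A₁' A₂ A₂' B₁ B₁' B₂ B₂' : C}
    (S : Fam A₁ A₁' A₂ A₂') (T : Fam B₁ B₁' B₂ B₂') :
    Fam (A₁ ⊗ B₁) (A₁' ⊗ B₁') (A₂ ⊗ B₂) (A₂' ⊗ B₂') :=
  fun X X' φ => onPair S B₂ B₂' X X' (ext A₁ A₁' T X X' φ)

/-- Interchange law for the parallel composition of slots with locally-applicable
transformations: `(S' ⊡ T') ∘ (S ⊡ T) = (S' ∘ S) ⊡ (T' ∘ T)` componentwise. -/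
theorem boxTimes_interchange {A₁ A₁' A₂ A₂' A₃ A₃' B₁ B₁' B₂ B₂' B₃ B₃' : C}
    (S : Fam A₁ A₁' A₂ A₂') (S' : Fam A₂ A₂' A₃ A₃')
    (T : Fam B₁ B₁' B₂ B₂') (T' : Fam B₂ B₂' B₃ B₃')
    (hS : IsSlot S) (hS' : IsSlot S') (hT : IsLAT T) (hT' : IsLAT T')
    (X X' : C) (φ : (A₁ ⊗ B₁) ⊗ X ⟶ (A₁' ⊗ B₁') ⊗ X') :
    boxTimes S' T' X X' (boxTimes S T X X' φ) =
      boxTimes (fun Y Y' ψ => S' Y Y' (S Y Y' ψ) : Fam A₁ A₁' A₃ A₃')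
        (fun Y Y' ψ => T' Y Y' (T Y Y' ψ) : Fam B₁ B₁' B₃ B₃') X X' φ := by
  have key : ∀ ψ, boxTimes S' T' X X' (onPair S B₂ B₂' X X' ψ) =
      onPair S' B₃ B₃' X X' (onPair S B₃ B₃' X X' (ext A₁ A₁' T' X X' ψ)) := by
    intro ψ
    unfold boxTimes
    rw [hS.2 T' hT']
  change boxTimes S' T' X X' (onPair S B₂ B₂' X X' (ext A₁ A₁' T X X' φ)) = _
  rw [key]
  simp only [boxTimes, onPair, ext, Category.assoc, Iso.inv_hom_id_assoc, Iso.inv_hom_id,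
    Category.comp_id, ← comp_whiskerRight_assoc, ← comp_whiskerRight,
    SymmetricCategory.symmetry, SymmetricCategory.symmetry_assoc, id_whiskerRight,
    Category.id_comp]
end

section
/- In a compact closed setting, every morphism between dual pairs induces a locally-applicable transformation: let P be a symmetric monoidal category, let A and B be objects with right duals Aᘁ, Bᘁ, let A', B' be objects, and let S : Aᘁ ⊗ A' ⟶ Bᘁ ⊗ B' be any morphism. Then the induced family F(S) is natural in X and X': for all a : Y ⟶ X, b : X' ⟶ Y' and φ : A ⊗ X ⟶ A' ⊗ X', F(S)_{Y,Y'}((𝟙_{A'} ⊗ b) ∘ φ ∘ (𝟙_A ⊗ a)) = (𝟙_{B'} ⊗ b) ∘ F(S)_{X,X'}(φ) ∘ (𝟙_B ⊗ a). -/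
open CategoryTheory MonoidalCategory

universe v u

variable {P : Type u} [Category.{v} P] [MonoidalCategory P] [SymmetricCategory P]

/-- The family `F(S)` induced by a morphism `S : Aᘁ ⊗ A' ⟶ Bᘁ ⊗ B'` between dual pairs:
`F(S)_{X,X'}(φ) = (𝟙_{B'⊗X'} ⊗ ε_B) ∘ (β_{Bᘁ,B'⊗X'} ⊗ 𝟙_B) ∘ (S ⊗ 𝟙_{X'⊗B}) ∘
(β_{A'⊗X',Aᘁ} ⊗ 𝟙_B) ∘ (φ ⊗ 𝟙_{Aᘁ⊗B}) ∘ (𝟙_A ⊗ β_{Aᘁ⊗B,X}) ∘ (η_A ⊗ 𝟙_{B⊗X})`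
(associators and unitors inserted). -/
def Fmap (A Ad A' B Bd B' : P) [ExactPairing A Ad] [ExactPairing B Bd]
    (S : Ad ⊗ A' ⟶ Bd ⊗ B') (X X' : P) (φ : A ⊗ X ⟶ A' ⊗ X') : B ⊗ X ⟶ B' ⊗ X' :=
  (λ_ (B ⊗ X)).inv ≫ ((η_ A Ad) ▷ (B ⊗ X)) ≫
    (α_ A Ad (B ⊗ X)).hom ≫ (A ◁ (α_ Ad B X).inv) ≫
    (A ◁ (β_ (Ad ⊗ B) X).hom) ≫ (α_ A X (Ad ⊗ B)).inv ≫
    (φ ▷ (Ad ⊗ B)) ≫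
    (α_ (A' ⊗ X') Ad B).inv ≫ ((β_ (A' ⊗ X') Ad).hom ▷ B) ≫
    ((α_ Ad A' X').inv ▷ B) ≫ (α_ (Ad ⊗ A') X' B).hom ≫
    (S ▷ (X' ⊗ B)) ≫
    (α_ (Bd ⊗ B') X' B).inv ≫ ((α_ Bd B' X').hom ▷ B) ≫
    ((β_ Bd (B' ⊗ X')).hom ▷ B) ≫ (α_ (B' ⊗ X') Bd B).hom ≫
    ((B' ⊗ X') ◁ (ε_ B Bd)) ≫ (ρ_ (B' ⊗ X')).hom

/-- The induced family `F(S)` is natural in the extension objects `X, X'`, i.e. it is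
a locally-applicable transformation of type `[A,A'] → [B,B']`. -/
theorem Fmap_natural (A Ad A' B Bd B' : P) [ExactPairing A Ad] [ExactPairing B Bd]
    (S : Ad ⊗ A' ⟶ Bd ⊗ B')
    {X X' Y Y' : P} (a : Y ⟶ X) (b : X' ⟶ Y') (φ : A ⊗ X ⟶ A' ⊗ X') :
    Fmap A Ad A' B Bd B' S Y Y' ((A ◁ a) ≫ φ ≫ (A' ◁ b)) =
      (B ◁ a) ≫ Fmap A Ad A' B Bd B' S X X' φ ≫ (B' ◁ b) := by
  have pre : (B ◁ a) ≫ (λ_ (B ⊗ X)).inv ≫ ((η_ A Ad) ▷ (B ⊗ X)) ≫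
      (α_ A Ad (B ⊗ X)).hom ≫ (A ◁ (α_ Ad B X).inv) ≫
      (A ◁ (β_ (Ad ⊗ B) X).hom) ≫ (α_ A X (Ad ⊗ B)).inv =
      (λ_ (B ⊗ Y)).inv ≫ ((η_ A Ad) ▷ (B ⊗ Y)) ≫
      (α_ A Ad (B ⊗ Y)).hom ≫ (A ◁ (α_ Ad B Y).inv) ≫
      (A ◁ (β_ (Ad ⊗ B) Y).hom) ≫ (α_ A Y (Ad ⊗ B)).inv ≫ ((A ◁ a) ▷ (Ad ⊗ B)) := by
    have h1 : A ◁ Ad ◁ B ◁ a ≫ A ◁ (α_ Ad B X).inv =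
        A ◁ (α_ Ad B Y).inv ≫ A ◁ ((Ad ⊗ B) ◁ a) := by
      simp only [← whiskerLeft_comp, associator_inv_naturality_right]
    have h2 : A ◁ ((Ad ⊗ B) ◁ a) ≫ A ◁ (β_ (Ad ⊗ B) X).hom =
        A ◁ (β_ (Ad ⊗ B) Y).hom ≫ A ◁ (a ▷ (Ad ⊗ B)) := by
      simp only [← whiskerLeft_comp, BraidedCategory.braiding_naturality_right]
    rw [leftUnitor_inv_naturality_assoc, whisker_exchange_assoc,
      associator_naturality_right_assoc, reassoc_of% h1, reassoc_of% h2,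
      associator_inv_naturality_middle]
  have post : ((A' ◁ b) ▷ (Ad ⊗ B)) ≫
      (α_ (A' ⊗ Y') Ad B).inv ≫ ((β_ (A' ⊗ Y') Ad).hom ▷ B) ≫
      ((α_ Ad A' Y').inv ▷ B) ≫ (α_ (Ad ⊗ A') Y' B).hom ≫
      (S ▷ (Y' ⊗ B)) ≫
      (α_ (Bd ⊗ B') Y' B).inv ≫ ((α_ Bd B' Y').hom ▷ B) ≫
      ((β_ Bd (B' ⊗ Y')).hom ▷ B) ≫ (α_ (B' ⊗ Y') Bd B).hom ≫
      ((B' ⊗ Y') ◁ (ε_ B Bd)) ≫ (ρ_ (B' ⊗ Y')).hom =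
      (α_ (A' ⊗ X') Ad B).inv ≫ ((β_ (A' ⊗ X') Ad).hom ▷ B) ≫
      ((α_ Ad A' X').inv ▷ B) ≫ (α_ (Ad ⊗ A') X' B).hom ≫
      (S ▷ (X' ⊗ B)) ≫
      (α_ (Bd ⊗ B') X' B).inv ≫ ((α_ Bd B' X').hom ▷ B) ≫
      ((β_ Bd (B' ⊗ X')).hom ▷ B) ≫ (α_ (B' ⊗ X') Bd B).hom ≫
      ((B' ⊗ X') ◁ (ε_ B Bd)) ≫ (ρ_ (B' ⊗ X')).hom ≫ (B' ◁ b) := by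
    have h1 : ((A' ◁ b) ▷ Ad) ▷ B ≫ (β_ (A' ⊗ Y') Ad).hom ▷ B =
        (β_ (A' ⊗ X') Ad).hom ▷ B ≫ (Ad ◁ (A' ◁ b)) ▷ B := by
      simp only [← comp_whiskerRight, BraidedCategory.braiding_naturality_left]
    have h2 : (Ad ◁ (A' ◁ b)) ▷ B ≫ (α_ Ad A' Y').inv ▷ B =
        (α_ Ad A' X').inv ▷ B ≫ ((Ad ⊗ A') ◁ b) ▷ B := by
      simp only [← comp_whiskerRight, associator_inv_naturality_right]
    have h3 : ((Bd ⊗ B') ◁ b) ▷ B ≫ (α_ Bd B' Y').hom ▷ B =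
        (α_ Bd B' X').hom ▷ B ≫ (Bd ◁ (B' ◁ b)) ▷ B := by
      simp only [← comp_whiskerRight, associator_naturality_right]
    have h4 : (Bd ◁ (B' ◁ b)) ▷ B ≫ (β_ Bd (B' ⊗ Y')).hom ▷ B =
        (β_ Bd (B' ⊗ X')).hom ▷ B ≫ ((B' ◁ b) ▷ Bd) ▷ B := by
      simp only [← comp_whiskerRight, BraidedCategory.braiding_naturality_right]
    rw [associator_inv_naturality_left_assoc, reassoc_of% h1, reassoc_of% h2,
      associator_naturality_middle_assoc, whisker_exchange_assoc,
      associator_inv_naturality_middle_assoc, reassoc_of% h3, reassoc_of% h4,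
      associator_naturality_left_assoc, ← whisker_exchange_assoc, rightUnitor_naturality]
  unfold Fmap
  simp only [comp_whiskerRight, Category.assoc]
  rw [post]
  have pre' := pre =≫ (φ ▷ (Ad ⊗ B))
  simp only [Category.assoc] at pre'
  rw [← reassoc_of% pre']
end

section
/- The assignment S ↦ F(S) is functorial with respect to plugging: let P be a symmetric monoidal category, let A, B, D be objects with right duals Aᘁ, Bᘁ, Dᘁ and let A', B', D' be objects. For all morphisms S : Aᘁ ⊗ A' ⟶ Bᘁ ⊗ B' and T : Bᘁ ⊗ B' ⟶ Dᘁ ⊗ D', and for all objects X, X' and every φ : A ⊗ X ⟶ A' ⊗ X', one has F(T ∘ S)_{X,X'}(φ) = F(T)_{X,X'}(F(S)_{X,X'}(φ)). -/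
open CategoryTheory MonoidalCategory

universe v u

variable {P : Type u} [Category.{v} P] [MonoidalCategory P] [SymmetricCategory P]

open BraidedCategory in
lemma Fmap_aux1 (A Ad B X Y : P) [ExactPairing A Ad] (φ : A ⊗ X ⟶ Y) :
    (λ_ (B ⊗ X)).inv ≫ ((η_ A Ad) ▷ (B ⊗ X)) ≫
    (α_ A Ad (B ⊗ X)).hom ≫ (A ◁ (α_ Ad B X).inv) ≫
    (A ◁ (β_ (Ad ⊗ B) X).hom) ≫ (α_ A X (Ad ⊗ B)).inv ≫
    (φ ▷ (Ad ⊗ B)) ≫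
    (α_ Y Ad B).inv ≫ ((β_ Y Ad).hom ▷ B) =
    (β_ B X).hom ≫ ((λ_ X).inv ≫ (η_ A Ad ≫ (β_ Ad A).inv) ▷ X ≫ (α_ Ad A X).hom ≫ Ad ◁ φ) ▷ B := by
  have h1 : (φ ▷ (Ad ⊗ B)) ≫ (α_ Y Ad B).inv ≫ ((β_ Y Ad).hom ▷ B) =
      (α_ _ _ _).inv ≫ (β_ (A ⊗ X) Ad).hom ▷ B ≫ (Ad ◁ φ) ▷ B := by
    rw [← comp_whiskerRight, ← braiding_naturality_left, comp_whiskerRight]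
    simp only [whiskerRight_tensor, Category.assoc, Iso.hom_inv_id_assoc]
  have h2 : (β_ B X).hom ≫ (λ_ X).inv ▷ B ≫ (η_ A Ad ▷ X) ▷ B =
      (λ_ (B ⊗ X)).inv ≫ ((η_ A Ad) ▷ (B ⊗ X)) ≫ (A ⊗ Ad) ◁ (β_ B X).hom ≫ (α_ _ _ _).inv := by
    rw [← whisker_exchange_assoc]
    simp
  have h3 : (A ◁ (α_ Ad B X).inv) ≫
    (A ◁ (β_ (Ad ⊗ B) X).hom) ≫ (α_ A X (Ad ⊗ B)).inv ≫ (α_ _ _ _).inv ≫ (β_ (A ⊗ X) Ad).hom ▷ B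
      = A ◁ Ad ◁ (β_ B X).hom ≫ (α_ _ _ _).inv ≫ (α_ _ _ _).inv ≫ (β_ A Ad).hom ▷ X ▷ B ≫
        (α_ Ad A X).hom ▷ B := by
    have h4 : A ◁ (β_ Ad X).hom ▷ B ≫ (A ◁ (α_ X Ad B).hom ≫ (α_ A X (Ad ⊗ B)).inv ≫
        (α_ (A ⊗ X) Ad B).inv ≫ (α_ A X Ad).hom ▷ B) ≫ (A ◁ (β_ X Ad).hom) ▷ B
        = (α_ _ _ _).inv := by
      have : (A ◁ (α_ X Ad B).hom ≫ (α_ A X (Ad ⊗ B)).inv ≫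
        (α_ (A ⊗ X) Ad B).inv ≫ (α_ A X Ad).hom ▷ B) = (α_ _ _ _).inv := by monoidal
      rw [this, ← associator_inv_naturality_middle, ← whiskerLeft_comp_assoc, ← comp_whiskerRight]
      simp
    simp only [Category.assoc] at h4
    simp only [braiding_tensor_left_hom, comp_whiskerRight, whiskerLeft_comp, Category.assoc,
      whiskerLeft_inv_hom_assoc]
    rw [reassoc_of% h4]
    monoidal
  rw [h1, reassoc_of% h3]
  simp only [comp_whiskerRight, Category.assoc]
  rw [reassoc_of% h2, ← SymmetricCategory.braiding_swap_eq_inv_braiding]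
  monoidal

open BraidedCategory in
lemma Fmap_aux2 (B Bd Y : P) [ExactPairing B Bd] :
    ((β_ Bd Y).hom ▷ B) ≫ (α_ Y Bd B).hom ≫ (Y ◁ (ε_ B Bd)) ≫ (ρ_ Y).hom =
    (β_ (Bd ⊗ Y) B).hom ≫ (α_ _ _ _).inv ≫ ((β_ B Bd).hom ≫ ε_ B Bd) ▷ Y ≫ (λ_ Y).hom := by
  have h1 : (Y ◁ (ε_ B Bd)) ≫ (ρ_ Y).hom = (β_ Y (Bd ⊗ B)).hom ≫ ε_ B Bd ▷ Y ≫ (λ_ Y).hom := by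
    rw [← braiding_naturality_right_assoc, braiding_leftUnitor]
  rw [h1]
  simp only [braiding_tensor_left_hom, braiding_tensor_right_hom, comp_whiskerRight,
    Category.assoc, Iso.hom_inv_id_assoc]
  rw [← comp_whiskerRight_assoc, ← comp_whiskerRight_assoc]
  simp

/-- Currying along the swapped pairing. -/
def Fcur (A Ad X Y : P) [ExactPairing A Ad] : (A ⊗ X ⟶ Y) ≃ (X ⟶ Ad ⊗ Y) :=
  letI := BraidedCategory.exactPairing_swap A Ad
  tensorLeftHomEquiv X Ad A Y

lemma Fcur_apply (A Ad X Y : P) [ExactPairing A Ad] (φ : A ⊗ X ⟶ Y) :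
    Fcur A Ad X Y φ =
      (λ_ X).inv ≫ (η_ A Ad ≫ (β_ Ad A).inv) ▷ X ≫ (α_ Ad A X).hom ≫ Ad ◁ φ := rfl

lemma Fcur_symm_apply (A Ad X Y : P) [ExactPairing A Ad] (g : X ⟶ Ad ⊗ Y) :
    (Fcur A Ad X Y).symm g =
      A ◁ g ≫ (α_ _ _ _).inv ≫ ((β_ A Ad).hom ≫ ε_ A Ad) ▷ Y ≫ (λ_ Y).hom := rfl

lemma Fmap_eq (A Ad A' B Bd B' : P) [ExactPairing A Ad] [ExactPairing B Bd]
    (S : Ad ⊗ A' ⟶ Bd ⊗ B') (X X' : P) (φ : A ⊗ X ⟶ A' ⊗ X') :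
    Fmap A Ad A' B Bd B' S X X' φ = (Fcur B Bd X (B' ⊗ X')).symm
      (Fcur A Ad X (A' ⊗ X') φ ≫ (α_ _ _ _).inv ≫ S ▷ X' ≫ (α_ _ _ _).hom) := by
  have h := Fmap_aux1 A Ad B X _ φ
  rw [← Fcur_apply] at h
  have h' := congrArg (· ≫ (((α_ Ad A' X').inv ▷ B) ≫ (α_ (Ad ⊗ A') X' B).hom ≫
    (S ▷ (X' ⊗ B)) ≫
    (α_ (Bd ⊗ B') X' B).inv ≫ ((α_ Bd B' X').hom ▷ B) ≫
    ((β_ Bd (B' ⊗ X')).hom ▷ B) ≫ (α_ (B' ⊗ X') Bd B).hom ≫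
    ((B' ⊗ X') ◁ (ε_ B Bd)) ≫ (ρ_ (B' ⊗ X')).hom)) h
  simp only [Category.assoc] at h'
  rw [Fmap, h', Fmap_aux2, Fcur_symm_apply]
  have h3 : (α_ (Ad ⊗ A') X' B).hom ≫ (S ▷ (X' ⊗ B)) ≫ (α_ (Bd ⊗ B') X' B).inv = S ▷ X' ▷ B := by
    simp
  rw [reassoc_of% h3]
  simp only [← comp_whiskerRight_assoc, Category.assoc]
  rw [BraidedCategory.braiding_naturality_left_assoc, SymmetricCategory.symmetry_assoc]

/-- The assignment `S ↦ F(S)` is functorial with respect to plugging: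
`F(T ∘ S) = F(T) ∘ F(S)` componentwise. -/
theorem Fmap_comp (A Ad A' B Bd B' D Dd D' : P)
    [ExactPairing A Ad] [ExactPairing B Bd] [ExactPairing D Dd]
    (S : Ad ⊗ A' ⟶ Bd ⊗ B') (T : Bd ⊗ B' ⟶ Dd ⊗ D')
    (X X' : P) (φ : A ⊗ X ⟶ A' ⊗ X') :
    Fmap A Ad A' D Dd D' (S ≫ T) X X' φ =
      Fmap B Bd B' D Dd D' T X X' (Fmap A Ad A' B Bd B' S X X' φ) := by
  simp only [Fmap_eq, Equiv.apply_symm_apply, comp_whiskerRight, Category.assoc,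
    Iso.hom_inv_id_assoc]
end

section
/- The quantum switch is single-party representable (it is a comb in each of its two arguments): let Q and A be vector spaces over ℂ and let π₀, π₁ : Q →ₗ Q be linear maps with π₀ ∘ π₀ = π₀, π₁ ∘ π₁ = π₁ and π₀ ∘ π₁ = 0 = π₁ ∘ π₀. For linear maps φ₁, φ₂ : A →ₗ A define Switch(φ₁,φ₂) := π₀ ⊗ (φ₂ ∘ φ₁) + π₁ ⊗ (φ₁ ∘ φ₂) : Q ⊗ A →ₗ Q ⊗ A, where for linear maps p : Q →ₗ Q and f : A →ₗ A the map p ⊗ f denotes the induced linear map on the tensor product. Then for all φ₁, φ₂: (i) Switch(φ₁,φ₂) = (π₀ ⊗ id_A + π₁ ⊗ φ₁) ∘ (id_Q ⊗ φ₂) ∘ (π₀ ⊗ φ₁ + π₁ ⊗ id_A), and (ii) Switch(φ₁,φ₂) = (π₀ ⊗ φ₂ + π₁ ⊗ id_A) ∘ (id_Q ⊗ φ₁) ∘ (π₀ ⊗ id_A + π₁ ⊗ φ₂). -/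
open TensorProduct

/-- The quantum switch determined by a control `π₀, π₁` on `Q`:
`Switch(φ₁,φ₂) := π₀ ⊗ (φ₂ ∘ φ₁) + π₁ ⊗ (φ₁ ∘ φ₂)`. -/
noncomputable def Switch {Q A : Type*} [AddCommGroup Q] [Module ℂ Q]
    [AddCommGroup A] [Module ℂ A] (π₀ π₁ : Q →ₗ[ℂ] Q) (φ₁ φ₂ : A →ₗ[ℂ] A) :
    Q ⊗[ℂ] A →ₗ[ℂ] Q ⊗[ℂ] A :=
  TensorProduct.map π₀ (φ₂ ∘ₗ φ₁) + TensorProduct.map π₁ (φ₁ ∘ₗ φ₂)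

/-- The quantum switch is single-party representable: it is a comb in each of its two
arguments. -/
theorem switch_single_party_representable
    {Q A : Type*} [AddCommGroup Q] [Module ℂ Q] [AddCommGroup A] [Module ℂ A]
    (π₀ π₁ : Q →ₗ[ℂ] Q)
    (h₀ : π₀ ∘ₗ π₀ = π₀) (h₁ : π₁ ∘ₗ π₁ = π₁)
    (h₀₁ : π₀ ∘ₗ π₁ = 0) (h₁₀ : π₁ ∘ₗ π₀ = 0)
    (φ₁ φ₂ : A →ₗ[ℂ] A) :
    (Switch π₀ π₁ φ₁ φ₂ =
      (TensorProduct.map π₀ LinearMap.id + TensorProduct.map π₁ φ₁) ∘ₗ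
        (TensorProduct.map LinearMap.id φ₂) ∘ₗ
        (TensorProduct.map π₀ φ₁ + TensorProduct.map π₁ LinearMap.id)) ∧
    (Switch π₀ π₁ φ₁ φ₂ =
      (TensorProduct.map π₀ φ₂ + TensorProduct.map π₁ LinearMap.id) ∘ₗ
        (TensorProduct.map LinearMap.id φ₁) ∘ₗ
        (TensorProduct.map π₀ LinearMap.id + TensorProduct.map π₁ φ₂)) := by
  constructor <;>
    simp only [Switch, LinearMap.comp_add, LinearMap.add_comp, ← TensorProduct.map_comp,
      LinearMap.id_comp, LinearMap.comp_id, h₀, h₁, h₀₁, h₁₀, TensorProduct.map_zero_left,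
      add_zero, zero_add]
end
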